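/- For any zero-error multi-sender index code for the three-sender configuration of Example 4 (message-index sets S_1={1,2,3}, S_2={2,3,4}, S_3={1,2,4,5}; side information A_1={4,5}, A_2={1,3,5}, A_3={1,2}, A_4={2,3,5}, A_5={3}), the following cardinality bounds hold: |M_3| ≤ |L_1||L_2|, |M_5| ≤ |L_3|, |M_1||M_3| ≤ |L_1||L_2||L_3|, |M_1||M_5| ≤ |L_1||L_3|, |M_4||M_5| ≤ |L_2||L_3|, |M_1||M_2||M_5| ≤ |L_1||L_2||L_3|, |M_1||M_4||M_5| ≤ |L_1||L_2||L_3|, |M_2||M_4||M_5| ≤ |L_1||L_2||L_3|, and |M_3||M_4||M_5| ≤ |L_1||L_2||L_3|. (These are the specialized MAIS outer bounds (28) matching the capacity region of Example 4.) -/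

import Mathlib

/-- A zero-error multi-sender index code: sender `k` knows the messages indexed by `S k`,
receiver `j` knows the messages indexed by `A j` and must decode message `j`. -/
structure MultiSenderCode (N K : ℕ) (S : Fin K → Finset (Fin N)) (A : Fin N → Finset (Fin N))
    (Mt : Fin N → Type) (Lt : Fin K → Type) where
  f : ∀ k : Fin K, ((i : {i : Fin N // i ∈ S k}) → Mt i.1) → Lt k
  g : ∀ j : Fin N, (∀ k : Fin K, Lt k) → ((i : {i : Fin N // i ∈ A j}) → Mt i.1) → Mt j
  correct : ∀ (m : ∀ i : Fin N, Mt i) (j : Fin N),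
    g j (fun k => f k (fun i => m i.1)) (fun i => m i.1) = m j

/-- The 3 sender message-index sets of Example 4 (0-indexed):
`S_1={1,2,3}`, `S_2={2,3,4}`, `S_3={1,2,4,5}`. -/
def Sconf4 : Fin 3 → Finset (Fin 5)
  | 0 => {0, 1, 2} | 1 => {1, 2, 3} | 2 => {0, 1, 3, 4}

/-- The side information of Example 4 (0-indexed): `A_1={4,5}`, `A_2={1,3,5}`,
`A_3={1,2}`, `A_4={2,3,5}`, `A_5={3}`. -/
def Aconf4 : Fin 5 → Finset (Fin 5)
  | 0 => {3, 4} | 1 => {0, 2, 4} | 2 => {0, 1} | 3 => {1, 2, 4} | 4 => {2}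

namespace MultiSenderCode

variable {N K : ℕ} {S : Fin K → Finset (Fin N)} {A : Fin N → Finset (Fin N)}
  {Mt : Fin N → Type} {Lt : Fin K → Type}

/-- Two message tuples with the same codewords agree as soon as they agree off a set `T` on which
the side information is acyclic, as witnessed by the decoding rank `r`. -/
theorem eq_of_codewords_eq (code : MultiSenderCode N K S A Mt Lt) (T : Finset (Fin N))
    (r : Fin N → ℕ) (hr : ∀ j ∈ T, ∀ i ∈ A j, i ∈ T → r i < r j)
    {m m' : ∀ i, Mt i} (hoff : ∀ i ∉ T, m i = m' i)
    (hcode : ∀ k, code.f k (fun i => m i.1) = code.f k (fun i => m' i.1)) : m = m' := by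
  have key : ∀ n j, r j < n → m j = m' j := by
    intro n
    induction n with
    | zero => intro j hj; omega
    | succ n ih =>
      intro j hj
      by_cases hjT : j ∈ T
      · rw [← code.correct m j, ← code.correct m' j, funext hcode]
        congr 1
        funext i
        by_cases hi : i.1 ∈ T
        · exact ih i.1 (by have := hr j hjT i.1 i.2 hi; omega)
        · exact hoff i.1 hi
      · exact hoff j hjT
  exact funext fun j => key (r j + 1) j (Nat.lt_succ_self _)

/-- The acyclic-subgraph outer bound: messages in a set `T` with acyclic side information are
jointly recoverable from the senders in `U`, when all other senders know no message in `T`. -/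
theorem prod_card_le_of_acyclic [∀ i, Fintype (Mt i)] [∀ i, Nonempty (Mt i)]
    [∀ k, Fintype (Lt k)] (code : MultiSenderCode N K S A Mt Lt)
    (T : Finset (Fin N)) (U : Finset (Fin K)) (r : Fin N → ℕ)
    (hU : ∀ k ∉ U, Disjoint (S k) T) (hr : ∀ j ∈ T, ∀ i ∈ A j, i ∈ T → r i < r j) :
    ∏ i ∈ T, Fintype.card (Mt i) ≤ ∏ k ∈ U, Fintype.card (Lt k) := by
  classical
  let extend (x : ∀ i : T, Mt i) (i : Fin N) : Mt i :=
    if h : i ∈ T then x ⟨i, h⟩ else Classical.arbitrary (Mt i)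
  let encode (x : ∀ i : T, Mt i) (k : U) : Lt k := code.f k (fun i => extend x i.1)
  have hinj : Function.Injective encode := by
    intro x y hxy
    have hext : extend x = extend y := by
      refine code.eq_of_codewords_eq T r hr (fun i hi => by simp [extend, hi]) fun k => ?_
      by_cases hk : k ∈ U
      · exact congrFun hxy ⟨k, hk⟩
      · congr 1
        funext i
        have hi : i.1 ∉ T := Finset.disjoint_left.mp (hU k hk) i.2
        simp [extend, hi]
    funext i
    simpa [extend] using congrFun hext i.1
  have hcard := Fintype.card_le_of_injective encode hinj
  rw [Fintype.card_pi, Fintype.card_pi] at hcard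
  rwa [Finset.prod_coe_sort T fun i => Fintype.card (Mt i),
    Finset.prod_coe_sort U fun k => Fintype.card (Lt k)] at hcard

end MultiSenderCode

/-- The specialized MAIS outer bounds (28) of Example 4 in zero-error combinatorial form
(0-indexed messages `M 0, …, M 4` and senders `L 0, L 1, L 2`). -/
theorem example4_MAIS_cardinality_bounds
    {Mt : Fin 5 → Type} {Lt : Fin 3 → Type}
    [∀ i, Fintype (Mt i)] [∀ i, Nonempty (Mt i)] [∀ k, Fintype (Lt k)]
    (code : MultiSenderCode 5 3 Sconf4 Aconf4 Mt Lt) :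
    Fintype.card (Mt 2) ≤ Fintype.card (Lt 0) * Fintype.card (Lt 1) ∧
    Fintype.card (Mt 4) ≤ Fintype.card (Lt 2) ∧
    Fintype.card (Mt 0) * Fintype.card (Mt 2) ≤
      Fintype.card (Lt 0) * Fintype.card (Lt 1) * Fintype.card (Lt 2) ∧
    Fintype.card (Mt 0) * Fintype.card (Mt 4) ≤
      Fintype.card (Lt 0) * Fintype.card (Lt 2) ∧
    Fintype.card (Mt 3) * Fintype.card (Mt 4) ≤
      Fintype.card (Lt 1) * Fintype.card (Lt 2) ∧
    Fintype.card (Mt 0) * Fintype.card (Mt 1) * Fintype.card (Mt 4) ≤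
      Fintype.card (Lt 0) * Fintype.card (Lt 1) * Fintype.card (Lt 2) ∧
    Fintype.card (Mt 0) * Fintype.card (Mt 3) * Fintype.card (Mt 4) ≤
      Fintype.card (Lt 0) * Fintype.card (Lt 1) * Fintype.card (Lt 2) ∧
    Fintype.card (Mt 1) * Fintype.card (Mt 3) * Fintype.card (Mt 4) ≤
      Fintype.card (Lt 0) * Fintype.card (Lt 1) * Fintype.card (Lt 2) ∧
    Fintype.card (Mt 2) * Fintype.card (Mt 3) * Fintype.card (Mt 4) ≤
      Fintype.card (Lt 0) * Fintype.card (Lt 1) * Fintype.card (Lt 2) := by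
  refine ⟨?_, ?_, ?_, ?_, ?_, ?_, ?_, ?_, ?_⟩
  · simpa [mul_assoc] using code.prod_card_le_of_acyclic {2} {0, 1}
      ![0, 0, 0, 0, 0] (by decide) (by decide)
  · simpa [mul_assoc] using code.prod_card_le_of_acyclic {4} {2}
      ![0, 0, 0, 0, 0] (by decide) (by decide)
  · simpa [mul_assoc] using code.prod_card_le_of_acyclic {0, 2} {0, 1, 2}
      ![0, 0, 1, 0, 0] (by decide) (by decide)
  · simpa [mul_assoc] using code.prod_card_le_of_acyclic {0, 4} {0, 2}
      ![1, 0, 0, 0, 0] (by decide) (by decide)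
  · simpa [mul_assoc] using code.prod_card_le_of_acyclic {3, 4} {1, 2}
      ![0, 0, 0, 1, 0] (by decide) (by decide)
  · simpa [mul_assoc] using code.prod_card_le_of_acyclic {0, 1, 4} {0, 1, 2}
      ![1, 2, 0, 0, 0] (by decide) (by decide)
  · simpa [mul_assoc] using code.prod_card_le_of_acyclic {0, 3, 4} {0, 1, 2}
      ![2, 0, 0, 1, 0] (by decide) (by decide)
  · simpa [mul_assoc] using code.prod_card_le_of_acyclic {1, 3, 4} {0, 1, 2}
      ![0, 1, 0, 2, 0] (by decide) (by decide)
  · simpa [mul_assoc] using code.prod_card_le_of_acyclic {2, 3, 4} {0, 1, 2}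
      ![0, 0, 0, 2, 1] (by decide) (by decide)
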